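/- Let H be a real separable Hilbert space and let A and B be bounded self-adjoint positive operators on H. Suppose (u_j)_{j≥1} is an orthonormal basis of H with A(u_j) = λ_j u_j where λ_1 > λ_2 > … > 0 (simple, strictly decreasing eigenvalues), and (v_j)_{j≥1} is an orthonormal basis of H with B(v_j) = μ_j v_j where μ_1 ≥ μ_2 ≥ … ≥ 0. Define u′_j = sgn(⟨v_j, u_j⟩_H) · u_j, where sgn(t) = 1 if t ≥ 0 and sgn(t) = −1 otherwise, and set a_1 = 2√2/(λ_1 − λ_2) and a_j = 2√2 · max((λ_{j−1} − λ_j)^{−1}, (λ_j − λ_{j+1})^{−1}) for j ≥ 2. Then for every j ≥ 1, ‖v_j − u′_j‖_H ≤ a_j ‖A − B‖_{ℒ(H)}. -/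

import Mathlib

open MeasureTheory ProbabilityTheory Filter Asymptotics
open scoped RealInnerProductSpace

noncomputable section

/-- `sgn(t) = 1` if `t ≥ 0` and `−1` otherwise. -/
def sgn (t : ℝ) : ℝ := if 0 ≤ t then 1 else -1

/-- The spectral-gap constants: `a_1 = 2√2/(λ_1 − λ_2)` and, for `j ≥ 2`,
`a_j = 2√2 · max((λ_{j−1} − λ_j)⁻¹, (λ_j − λ_{j+1})⁻¹)` (0-based indexing). -/
def gapSeq (lam : ℕ → ℝ) : ℕ → ℝ
  | 0 => 2 * Real.sqrt 2 * (lam 0 - lam 1)⁻¹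
  | j + 1 => 2 * Real.sqrt 2 * max ((lam j - lam (j + 1))⁻¹) ((lam (j + 1) - lam (j + 2))⁻¹)

section Eigenbasis

variable {H : Type*} [NormedAddCommGroup H] [InnerProductSpace ℝ H]

/-- A nonzero vector orthogonal to all `u k` with `j < k` and to all `v k` with `k < j`. -/
theorem exists_ne_zero_inner_eq_zero {u : ℕ → H} (hu : Orthonormal ℝ u) (v : ℕ → H) (j : ℕ) :
    ∃ x : H, x ≠ 0 ∧ (∀ k, j < k → ⟪u k, x⟫ = 0) ∧ ∀ k, k < j → ⟪v k, x⟫ = 0 := by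
  let w : Fin (j + 1) → H := fun i => u i
  have hw : LinearIndependent ℝ w := (hu.comp _ Fin.val_injective).linearIndependent
  let L : (Fin (j + 1) → ℝ) →ₗ[ℝ] H := Fintype.linearCombination ℝ w
  let F : (Fin (j + 1) → ℝ) →ₗ[ℝ] (Fin j → ℝ) :=
    (LinearMap.pi fun i : Fin j => (innerSL ℝ (v i)).toLinearMap) ∘ₗ L
  have hF : F.ker ≠ ⊥ := LinearMap.ker_ne_bot_of_finrank_lt (by simp)
  obtain ⟨c, hcF, hc⟩ := Submodule.exists_mem_ne_zero_of_ne_bot hF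
  refine ⟨L c, fun h => hc ?_, fun k hk => ?_, fun k hk => ?_⟩
  · exact funext (Fintype.linearIndependent_iff.mp hw c h)
  · simp only [L, Fintype.linearCombination_apply, inner_sum, real_inner_smul_right]
    refine Finset.sum_eq_zero fun i _ => ?_
    rw [hu.2 (by have := i.2; omega), mul_zero]
  · simpa [F] using congrFun (LinearMap.mem_ker.mp hcF) ⟨k, hk⟩

variable [CompleteSpace H]

theorem hasSum_inner_mul_inner_of_total {u : ℕ → H} (hu : Orthonormal ℝ u)
    (hu_total : (Submodule.span ℝ (Set.range u)).topologicalClosure = ⊤) (x y : H) :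
    HasSum (fun k => ⟪u k, x⟫ * ⟪u k, y⟫) ⟪x, y⟫ := by
  have h := (HilbertBasis.mk hu hu_total.ge).hasSum_inner_mul_inner x y
  simpa [real_inner_comm x] using h

theorem hasSum_sq_inner_of_total {u : ℕ → H} (hu : Orthonormal ℝ u)
    (hu_total : (Submodule.span ℝ (Set.range u)).topologicalClosure = ⊤) (x : H) :
    HasSum (fun k => ⟪u k, x⟫ ^ 2) (‖x‖ ^ 2) := by
  simpa [sq] using hasSum_inner_mul_inner_of_total hu hu_total x x

theorem inner_eigenvector_apply {T : H →L[ℝ] H} (hT : IsSelfAdjoint T) {u : H} {a : ℝ}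
    (hTu : T u = a • u) (x : H) : ⟪u, T x⟫ = a * ⟪u, x⟫ := by
  have h : ⟪T u, x⟫ = ⟪u, T x⟫ := hT.isSymmetric u x
  rw [← h, hTu, real_inner_smul_left]

theorem hasSum_mul_sq_inner_of_total {T : H →L[ℝ] H} (hT : IsSelfAdjoint T) {u : ℕ → H}
    {a : ℕ → ℝ} (hu : Orthonormal ℝ u)
    (hu_total : (Submodule.span ℝ (Set.range u)).topologicalClosure = ⊤)
    (hTu : ∀ j, T (u j) = a j • u j) (x : H) :
    HasSum (fun k => a k * ⟪u k, x⟫ ^ 2) ⟪T x, x⟫ := by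
  convert hasSum_inner_mul_inner_of_total hu hu_total (T x) x using 2 with k
  rw [inner_eigenvector_apply hT (hTu k)]
  ring

theorem eigenvalue_sub_le_norm_sub {S T : H →L[ℝ] H} (hS : IsSelfAdjoint S)
    (hT : IsSelfAdjoint T) {u v : ℕ → H} {a b : ℕ → ℝ} (hu : Orthonormal ℝ u)
    (hu_total : (Submodule.span ℝ (Set.range u)).topologicalClosure = ⊤)
    (hSu : ∀ j, S (u j) = a j • u j) (ha : Antitone a) (hv : Orthonormal ℝ v)
    (hv_total : (Submodule.span ℝ (Set.range v)).topologicalClosure = ⊤)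
    (hTv : ∀ j, T (v j) = b j • v j) (hb : Antitone b) (j : ℕ) :
    a j - b j ≤ ‖S - T‖ := by
  obtain ⟨x, hx, hxu, hxv⟩ := exists_ne_zero_inner_eq_zero hu v j
  have hSx : a j * ‖x‖ ^ 2 ≤ ⟪S x, x⟫ := by
    refine hasSum_le (fun k => ?_) ((hasSum_sq_inner_of_total hu hu_total x).mul_left (a j))
      (hasSum_mul_sq_inner_of_total hS hu hu_total hSu x)
    rcases lt_or_ge j k with hk | hk
    · simp [hxu k hk]
    · exact mul_le_mul_of_nonneg_right (ha hk) (sq_nonneg _)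
  have hTx : ⟪T x, x⟫ ≤ b j * ‖x‖ ^ 2 := by
    refine hasSum_le (fun k => ?_) (hasSum_mul_sq_inner_of_total hT hv hv_total hTv x)
      ((hasSum_sq_inner_of_total hv hv_total x).mul_left (b j))
    rcases lt_or_ge k j with hk | hk
    · simp [hxv k hk]
    · exact mul_le_mul_of_nonneg_right (hb hk) (sq_nonneg _)
  have hST : ⟪S x, x⟫ - ⟪T x, x⟫ ≤ ‖S - T‖ * ‖x‖ ^ 2 := by
    calc ⟪S x, x⟫ - ⟪T x, x⟫ = ⟪(S - T) x, x⟫ := by simp [inner_sub_left]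
      _ ≤ ‖(S - T) x‖ * ‖x‖ := real_inner_le_norm _ _
      _ ≤ ‖S - T‖ * ‖x‖ * ‖x‖ := by gcongr; exact (S - T).le_opNorm x
      _ = ‖S - T‖ * ‖x‖ ^ 2 := by ring
  have hpos : 0 < ‖x‖ ^ 2 := by positivity
  exact le_of_mul_le_mul_right (by linarith) hpos

/-- Weyl's inequality for eigenvalues listed in decreasing order. -/
theorem abs_eigenvalue_sub_le_norm_sub {S T : H →L[ℝ] H} (hS : IsSelfAdjoint S)
    (hT : IsSelfAdjoint T) {u v : ℕ → H} {a b : ℕ → ℝ} (hu : Orthonormal ℝ u)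
    (hu_total : (Submodule.span ℝ (Set.range u)).topologicalClosure = ⊤)
    (hSu : ∀ j, S (u j) = a j • u j) (ha : Antitone a) (hv : Orthonormal ℝ v)
    (hv_total : (Submodule.span ℝ (Set.range v)).topologicalClosure = ⊤)
    (hTv : ∀ j, T (v j) = b j • v j) (hb : Antitone b) (j : ℕ) :
    |a j - b j| ≤ ‖S - T‖ :=
  abs_sub_le_iff.mpr
    ⟨eigenvalue_sub_le_norm_sub hS hT hu hu_total hSu ha hv hv_total hTv hb j,
      norm_sub_rev T S ▸ eigenvalue_sub_le_norm_sub hT hS hv hv_total hTv hb hu hu_total hSu ha j⟩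

theorem sq_gap_mul_le_sq_norm_residual {T : H →L[ℝ] H} (hT : IsSelfAdjoint T) {u : ℕ → H}
    {a : ℕ → ℝ} (hu : Orthonormal ℝ u)
    (hu_total : (Submodule.span ℝ (Set.range u)).topologicalClosure = ⊤)
    (hTu : ∀ j, T (u j) = a j • u j) {g : ℝ} (hg : 0 ≤ g) {j : ℕ}
    (hgap : ∀ k, k ≠ j → g ≤ |a k - a j|) (x : H) :
    g ^ 2 * (‖x‖ ^ 2 - ⟪u j, x⟫ ^ 2) ≤ ‖T x - a j • x‖ ^ 2 := by
  have hx := ((hasSum_sq_inner_of_total hu hu_total x).sub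
    (hasSum_ite_eq j (⟪u j, x⟫ ^ 2))).mul_left (g ^ 2)
  refine hasSum_le (fun k => ?_) hx (hasSum_sq_inner_of_total hu hu_total (T x - a j • x))
  rw [inner_sub_right, inner_eigenvector_apply hT (hTu k), real_inner_smul_right, ← sub_mul,
    mul_pow]
  by_cases hk : k = j
  · simp [hk]
  · simp only [hk, if_false, sub_zero]
    rw [← sq_abs (a k - a j)]
    gcongr
    exact hgap k hk

end Eigenbasis

theorem sgn_mul_self (t : ℝ) : sgn t * t = |t| := by
  unfold sgn
  split_ifs with h
  · rw [one_mul, abs_of_nonneg h]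
  · rw [neg_one_mul, abs_of_neg (not_le.mp h)]

theorem sgn_sq (t : ℝ) : sgn t ^ 2 = 1 := by
  unfold sgn
  split_ifs <;> norm_num

theorem sq_norm_sub_sgn_smul_le {H : Type*} [NormedAddCommGroup H] [InnerProductSpace ℝ H]
    {x y : H} (hx : ‖x‖ = 1) (hy : ‖y‖ = 1) :
    ‖x - sgn ⟪x, y⟫ • y‖ ^ 2 ≤ 2 * (1 - ⟪x, y⟫ ^ 2) := by
  have hle : |⟪x, y⟫| ≤ 1 := by simpa [hx, hy] using abs_real_inner_le_norm x y
  rw [norm_sub_sq_real, real_inner_smul_right, sgn_mul_self, norm_smul, mul_pow, Real.norm_eq_abs,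
    sq_abs, sgn_sq, hx, hy, ← sq_abs ⟪x, y⟫]
  nlinarith [abs_nonneg ⟪x, y⟫]

theorem le_abs_sub_of_antitone {a : ℕ → ℝ} (ha : Antitone a) {g : ℝ} {j : ℕ}
    (hnext : g ≤ a j - a (j + 1)) (hprev : ∀ i, i + 1 = j → g ≤ a i - a j) {k : ℕ} (hk : k ≠ j) :
    g ≤ |a k - a j| := by
  rcases lt_or_gt_of_ne hk with h | h
  · obtain ⟨i, rfl⟩ : ∃ i, i + 1 = j := ⟨j - 1, by omega⟩
    exact ((hprev i rfl).trans (sub_le_sub_right (ha (by omega)) _)).trans (le_abs_self _)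
  · rw [abs_sub_comm]
    exact (hnext.trans (sub_le_sub_left (ha h) _)).trans (le_abs_self _)

theorem exists_gapSeq_eq {a : ℕ → ℝ} (ha : StrictAnti a) (j : ℕ) :
    ∃ g : ℝ, 0 < g ∧ gapSeq a j = 2 * Real.sqrt 2 * g⁻¹ ∧ ∀ k, k ≠ j → g ≤ |a k - a j| := by
  have hpos : ∀ i, 0 < a i - a (i + 1) := fun i => sub_pos.mpr (ha i.lt_succ_self)
  cases j with
  | zero =>
    exact ⟨_, hpos 0, rfl, fun k hk => le_abs_sub_of_antitone ha.antitone le_rfl (by simp) hk⟩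
  | succ j =>
    have hmax := (inv_pos.mpr (hpos j)).trans_le
      (le_max_left _ (a (j + 1) - a (j + 2))⁻¹)
    refine ⟨(max (a j - a (j + 1))⁻¹ (a (j + 1) - a (j + 2))⁻¹)⁻¹, inv_pos.mpr hmax,
      by rw [inv_inv, gapSeq], fun k hk => le_abs_sub_of_antitone ha.antitone ?_ ?_ hk⟩
    · exact inv_le_of_inv_le₀ (hpos _) (le_max_right _ _)
    · intro i hi
      obtain rfl : i = j := by omega
      exact inv_le_of_inv_le₀ (hpos _) (le_max_left _ _)

/-- Eigenvector perturbation bound: with `u′_j = sgn⟨v_j, u_j⟩ · u_j`,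
`‖v_j − u′_j‖ ≤ a_j ‖A − B‖` for every `j`. -/
theorem eigenvector_perturbation_bound
    {H : Type*} [NormedAddCommGroup H] [InnerProductSpace ℝ H] [CompleteSpace H]
    [TopologicalSpace.SeparableSpace H]
    (A B : H →L[ℝ] H) (hA : IsSelfAdjoint A) (hB : IsSelfAdjoint B)
    (hApos : ∀ x : H, 0 ≤ ⟪A x, x⟫) (hBpos : ∀ x : H, 0 ≤ ⟪B x, x⟫)
    (u v : ℕ → H) (lam mu : ℕ → ℝ)
    (hu : Orthonormal ℝ u) (hu_total : (Submodule.span ℝ (Set.range u)).topologicalClosure = ⊤)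
    (hAu : ∀ j, A (u j) = lam j • u j) (hlam_anti : StrictAnti lam) (hlam_pos : ∀ j, 0 < lam j)
    (hv : Orthonormal ℝ v) (hv_total : (Submodule.span ℝ (Set.range v)).topologicalClosure = ⊤)
    (hBv : ∀ j, B (v j) = mu j • v j) (hmu_anti : Antitone mu) (hmu_nonneg : ∀ j, 0 ≤ mu j) :
    ∀ j, ‖v j - sgn ⟪v j, u j⟫ • u j‖ ≤ gapSeq lam j * ‖A - B‖ := by
  intro j
  obtain ⟨g, hg, hgap, hsep⟩ := exists_gapSeq_eq hlam_anti j
  have hresid : ‖A (v j) - lam j • v j‖ ≤ 2 * ‖A - B‖ := by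
    calc ‖A (v j) - lam j • v j‖ = ‖(A - B) (v j) + (mu j - lam j) • v j‖ := by
          rw [sub_apply, hBv, sub_smul]
          congr 1
          abel
      _ ≤ ‖(A - B) (v j)‖ + ‖(mu j - lam j) • v j‖ := norm_add_le _ _
      _ ≤ ‖A - B‖ + ‖A - B‖ := by
          refine add_le_add ((A - B).unit_le_opNorm _ (hv.1 j).le) ?_
          rw [norm_smul, hv.1 j, mul_one, Real.norm_eq_abs, abs_sub_comm]
          exact abs_eigenvalue_sub_le_norm_sub hA hB hu hu_total hAu hlam_anti.antitone
            hv hv_total hBv hmu_anti j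
      _ = 2 * ‖A - B‖ := by ring
  have hsq := (sq_gap_mul_le_sq_norm_residual hA hu hu_total hAu hg.le hsep (v j)).trans
    (pow_le_pow_left₀ (norm_nonneg _) hresid 2)
  rw [hv.1 j, one_pow, real_inner_comm] at hsq
  have hdist := mul_le_mul_of_nonneg_left (sq_norm_sub_sgn_smul_le (hv.1 j) (hu.1 j)) (sq_nonneg g)
  have hmul : g * ‖v j - sgn ⟪v j, u j⟫ • u j‖ ≤ 2 * Real.sqrt 2 * ‖A - B‖ := by
    refine (sq_le_sq₀ (by positivity) (by positivity)).mp ?_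
    rw [mul_pow, mul_pow, mul_pow, Real.sq_sqrt zero_le_two]
    linarith
  rw [hgap, mul_right_comm, ← div_eq_mul_inv, le_div_iff₀ hg, mul_comm _ g]
  exact hmul

end
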